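/- arXiv:2603.16282 — 4 statements merged into one kernel-verified Lean document; each statement's English description precedes it below -/
import Mathlib

section
/- Let d ≥ 2 be an integer, q real, m ≤ n natural numbers, and t > 0. Then, as the real parameter p tends to +∞, M_{n−m}^{(p−2m−d+1, q+2m+d−1)}(t/p) tends to (−1)^{n−m}(n−m)! · L_{n−m}^{(q+2m+d−1)}(t). Consequently, for any spherical harmonic Y of degree m and any x ∈ ℝ^d, lim_{p→∞} S_{n,m}^{p,q,M}(x, t/p) = (−1)^{n−m}(n−m)! S_{n,m}^{q,L}(x,t), where S_{n,m}^{p,q,M}(x,t) = M_{n−m}^{(p−2m−d+1, q+2m+d−1)}(t) Y(x) and S_{n,m}^{q,L}(x,t) = L_{n−m}^{(q+2m+d−1)}(t) Y(x). -/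
open Real Filter

/-- First-class finite orthogonal polynomial `M_n^{(p,q)}` defined via the Rodrigues formula. -/
noncomputable def finiteM (p q : ℝ) (n : ℕ) (x : ℝ) : ℝ :=
  (-1 : ℝ) ^ n * (1 + x) ^ (p + q) * x ^ (-q) *
    iteratedDeriv n (fun y : ℝ => y ^ ((n : ℝ) + q) * (1 + y) ^ ((n : ℝ) - p - q)) x

/-- Generalized Laguerre polynomial `L_n^{(α)}` via the Rodrigues formula. -/
noncomputable def laguerre (α : ℝ) (n : ℕ) (x : ℝ) : ℝ :=
  x ^ (-α) * Real.exp x / (n.factorial : ℝ) *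
    iteratedDeriv n (fun y : ℝ => y ^ ((n : ℝ) + α) * Real.exp (-y)) x

/-- A spherical harmonic of degree `m`: a homogeneous polynomial of degree `m` on `ℝ^d`
that is annihilated by the Laplacian. -/
def IsSphericalHarmonic (d m : ℕ) (Y : MvPolynomial (Fin d) ℝ) : Prop :=
  Y.IsHomogeneous m ∧ ∑ i : Fin d, MvPolynomial.pderiv i (MvPolynomial.pderiv i Y) = 0


lemma aux_iter_rpow (r x : ℝ) (k : ℕ) :
    iteratedDeriv k (fun y : ℝ => y ^ r) x = (descPochhammer ℝ k).eval r * x ^ (r - k) := by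
  rw [iteratedDeriv_eq_iterate, Real.iter_deriv_rpow_const]

lemma aux_iter_rpow_one (r x : ℝ) (k : ℕ) :
    iteratedDeriv k (fun y : ℝ => (1 + y) ^ r) x =
      (descPochhammer ℝ k).eval r * (1 + x) ^ (r - k) := by
  have h := congrFun (iteratedDeriv_comp_const_add (n := k) (f := fun y : ℝ => y ^ r) (s := 1)) x
  rw [h, aux_iter_rpow]

lemma aux_iter_exp (x : ℝ) (k : ℕ) :
    iteratedDeriv k (fun y : ℝ => Real.exp (-y)) x = (-1) ^ k * Real.exp (-x) := by
  have h := congrFun (iteratedDeriv_exp_const_mul k (-1)) x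
  simpa using h

lemma aux_M (p q x : ℝ) (n : ℕ) (hx : 0 < x) :
    finiteM p q n x = (-1 : ℝ) ^ n * ∑ i ∈ Finset.range (n + 1),
      (n.choose i : ℝ) * (descPochhammer ℝ i).eval ((n : ℝ) + q) *
        ((descPochhammer ℝ (n - i)).eval ((n : ℝ) - p - q) * x ^ (n - i) * (1 + x) ^ i) := by
  have hx1 : 0 < 1 + x := by linarith
  unfold finiteM
  have h := iteratedDeriv_mul (n := n) (x := x) (f := fun y : ℝ => y ^ ((n : ℝ) + q))
    (g := fun y : ℝ => (1 + y) ^ ((n : ℝ) - p - q))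
    (Real.contDiffAt_rpow_const_of_ne hx.ne')
    (ContDiffAt.rpow_const_of_ne (contDiffAt_const.add contDiffAt_id) hx1.ne')
  have e : (fun y : ℝ => y ^ ((n : ℝ) + q) * (1 + y) ^ ((n : ℝ) - p - q)) =
    (fun y : ℝ => y ^ ((n : ℝ) + q)) * (fun y : ℝ => (1 + y) ^ ((n : ℝ) - p - q)) := rfl
  rw [e, h, mul_assoc, mul_assoc, Finset.mul_sum, Finset.mul_sum]
  congr 1
  refine Finset.sum_congr rfl fun i hi => ?_
  have hi' : i ≤ n := Nat.lt_succ_iff.mp (Finset.mem_range.mp hi)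
  rw [aux_iter_rpow, aux_iter_rpow_one]
  have e1 : x ^ (n - i) = x ^ (-q) * x ^ ((n : ℝ) + q - i) := by
    rw [← Real.rpow_add hx, ← Real.rpow_natCast, Nat.cast_sub hi']
    congr 1; ring
  have e2 : (1 + x) ^ i = (1 + x) ^ (p + q) * (1 + x) ^ ((n : ℝ) - p - q - ((n - i : ℕ) : ℝ)) := by
    rw [← Real.rpow_add hx1, ← Real.rpow_natCast, Nat.cast_sub hi']
    congr 1; ring
  rw [e1, e2]
  ring

lemma aux_L (a x : ℝ) (n : ℕ) (hx : 0 < x) :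
    (n.factorial : ℝ) * laguerre a n x = ∑ i ∈ Finset.range (n + 1),
      (n.choose i : ℝ) * (descPochhammer ℝ i).eval ((n : ℝ) + a) * (-x) ^ (n - i) := by
  unfold laguerre
  have h := iteratedDeriv_mul (n := n) (x := x) (f := fun y : ℝ => y ^ ((n : ℝ) + a))
    (g := fun y : ℝ => Real.exp (-y))
    (Real.contDiffAt_rpow_const_of_ne hx.ne') (by fun_prop)
  have e : (fun y : ℝ => y ^ ((n : ℝ) + a) * Real.exp (-y)) =
    (fun y : ℝ => y ^ ((n : ℝ) + a)) * (fun y : ℝ => Real.exp (-y)) := rfl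
  have hf : (n.factorial : ℝ) ≠ 0 := by positivity
  have e0 : ∀ A B : ℝ, (n.factorial : ℝ) * (A / n.factorial * B) = A * B := by
    intro A B; field_simp
  rw [e, h, e0, Finset.mul_sum]
  refine Finset.sum_congr rfl fun i hi => ?_
  have hi' : i ≤ n := Nat.lt_succ_iff.mp (Finset.mem_range.mp hi)
  rw [aux_iter_rpow, aux_iter_exp]
  have e1 : (-x) ^ (n - i) = (-1) ^ (n - i) * (x ^ (-a) * x ^ ((n : ℝ) + a - i)) := by
    rw [← Real.rpow_add hx, neg_pow, ← Real.rpow_natCast x, Nat.cast_sub hi']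
    congr 2; ring
  have e2 : Real.exp x * Real.exp (-x) = 1 := by rw [← Real.exp_add]; simp
  rw [e1]
  linear_combination (x ^ (-a) * (n.choose i : ℝ) * (descPochhammer ℝ i).eval ((n : ℝ) + a) *
    x ^ ((n : ℝ) + a - i) * (-1) ^ (n - i)) * e2

lemma aux_lim (c t : ℝ) (k : ℕ) :
    Tendsto (fun p : ℝ => (descPochhammer ℝ k).eval (c - p) * (t / p) ^ k) atTop
      (nhds ((-t) ^ k)) := by
  induction k with
  | zero => simp
  | succ k ih =>
    have h1 : Tendsto (fun p : ℝ => (c - p - k) * (t / p)) atTop (nhds (-t)) := by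
      have h2 : Tendsto (fun p : ℝ => (c - k) * (t / p) - t) atTop (nhds ((c - k) * 0 - t)) :=
        ((tendsto_const_nhds.div_atTop tendsto_id).const_mul _).sub_const _
      simp only [mul_zero, zero_sub] at h2
      refine h2.congr' ?_
      filter_upwards [eventually_gt_atTop 0] with p hp
      field_simp
      ring
    have h3 := ih.mul h1
    rw [pow_succ]
    refine h3.congr fun p => ?_
    rw [descPochhammer_succ_right]
    simp only [Polynomial.eval_mul, Polynomial.eval_sub, Polynomial.eval_X,
      Polynomial.eval_natCast]
    ring

lemma aux_main (q b t : ℝ) (n : ℕ) (ht : 0 < t) :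
    Tendsto (fun p : ℝ => finiteM (p - b) (q + b) n (t / p)) atTop
      (nhds ((-1 : ℝ) ^ n * (n.factorial : ℝ) * laguerre (q + b) n t)) := by
  rw [mul_assoc, aux_L _ _ _ ht]
  have h : Tendsto (fun p : ℝ => (-1 : ℝ) ^ n * ∑ i ∈ Finset.range (n + 1),
      (n.choose i : ℝ) * (descPochhammer ℝ i).eval ((n : ℝ) + (q + b)) *
        ((descPochhammer ℝ (n - i)).eval (((n : ℝ) - q) - p) * (t / p) ^ (n - i) *
          (1 + t / p) ^ i)) atTop
      (nhds ((-1 : ℝ) ^ n * ∑ i ∈ Finset.range (n + 1),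
      (n.choose i : ℝ) * (descPochhammer ℝ i).eval ((n : ℝ) + (q + b)) *
        ((-t) ^ (n - i) * (1 + 0) ^ i))) := by
    refine (tendsto_finsetSum _ fun i _ => ?_).const_mul _
    refine ((aux_lim _ t (n - i)).mul ?_).const_mul _
    exact ((tendsto_const_nhds.div_atTop tendsto_id).const_add 1).pow i
  simp only [add_zero, one_pow, mul_one] at h
  refine h.congr' ?_
  filter_upwards [eventually_gt_atTop 0] with p hp
  rw [aux_M _ _ _ _ (div_pos ht hp)]
  have e : (n : ℝ) - (p - b) - (q + b) = (n : ℝ) - q - p := by ring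
  rw [e]

theorem stmt13 (d : ℕ) (hd : 2 ≤ d) (q : ℝ) (m n : ℕ) (hmn : m ≤ n) (t : ℝ) (ht : 0 < t) :
    Tendsto (fun p : ℝ =>
        finiteM (p - 2 * m - d + 1) (q + 2 * m + d - 1) (n - m) (t / p)) atTop
      (nhds ((-1 : ℝ) ^ (n - m) * ((n - m).factorial : ℝ) *
        laguerre (q + 2 * (m : ℝ) + d - 1) (n - m) t)) ∧
    ∀ (Y : MvPolynomial (Fin d) ℝ), IsSphericalHarmonic d m Y → ∀ x : Fin d → ℝ,
      Tendsto (fun p : ℝ =>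
          finiteM (p - 2 * m - d + 1) (q + 2 * m + d - 1) (n - m) (t / p) *
            MvPolynomial.eval x Y) atTop
        (nhds ((-1 : ℝ) ^ (n - m) * ((n - m).factorial : ℝ) *
          (laguerre (q + 2 * (m : ℝ) + d - 1) (n - m) t * MvPolynomial.eval x Y))) := by

  have key : Tendsto (fun p : ℝ =>
        finiteM (p - 2 * m - d + 1) (q + 2 * m + d - 1) (n - m) (t / p)) atTop
      (nhds ((-1 : ℝ) ^ (n - m) * ((n - m).factorial : ℝ) *
        laguerre (q + 2 * (m : ℝ) + d - 1) (n - m) t)) := by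
    have h := aux_main q (2 * (m : ℝ) + d - 1) t (n - m) ht
    have e1 : ∀ p : ℝ, p - (2 * (m : ℝ) + d - 1) = p - 2 * m - d + 1 := fun p => by ring
    have e2 : q + (2 * (m : ℝ) + d - 1) = q + 2 * m + d - 1 := by ring
    simpa only [e1, e2] using h
  refine ⟨key, fun Y _ x => ?_⟩
  have h := key.mul_const (MvPolynomial.eval x Y)
  rwa [mul_assoc] at h
end

section
/- Let d ≥ 2 be an integer and m ≤ n natural numbers. Define g(t) = L_{n−m}^{(2m+d−2)}(t) · t^m for t > 0. Then for every t > 0: t g″(t) + (d−1−t) g′(t) − m(m+d−2) t^{−1} g(t) = −n g(t). (This is the radial form of the equation (t∂_t² + (d−1−t)∂_t + t^{−1}Δ₀^{(x)}) S = −n S satisfied by the Laguerre polynomials S_{n,m}^{−1,L}(x,t) = L_{n−m}^{(2m+d−2)}(t)Y(x) on the surface of the cone, using Δ₀Y = −m(m+d−2)Y for a degree-m spherical harmonic Y.) -/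
open Real

lemma lag_hasDeriv (w : ℝ → ℝ) (hw : ContDiff ℝ ⊤ w) (j : ℕ) (y : ℝ) :
    HasDerivAt (iteratedDeriv j w) (iteratedDeriv (j+1) w y) y := by
  rw [iteratedDeriv_succ]
  apply DifferentiableAt.hasDerivAt
  have := hw.differentiable_iteratedDeriv j (by exact_mod_cast WithTop.coe_lt_top _)
  exact this y

lemma lag_ode (N : ℕ) (D : ℕ → ℝ → ℝ) (hD : ∀ j y, HasDerivAt (D j) (D (j+1) y) y)
    (h0 : ∀ y, y * D 1 y = (N - y) * D 0 y) (j : ℕ) :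
    ∀ y, y * D (j+2) y + (j+1) * D (j+1) y = (N - y) * D (j+1) y - (j+1) * D j y := by
  induction j with
  | zero =>
    intro y
    have h1 := (hasDerivAt_id' y).mul (hD 1 y)
    have h2 := ((hasDerivAt_id' y).const_sub (N:ℝ)).mul (hD 0 y)
    have e : ((fun y => y) * D 1 : ℝ → ℝ) = (fun y => (N:ℝ) - y) * D 0 := funext h0
    rw [e] at h1
    have := h1.unique h2
    simp at this ⊢
    linarith
  | succ j ih =>
    intro y
    have h1 := ((hasDerivAt_id' y).mul (hD (j+2) y)).add ((hD (j+1) y).const_mul ((j:ℝ)+1))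
    have h2 := (((hasDerivAt_id' y).const_sub (N:ℝ)).mul (hD (j+1) y)).sub
      ((hD j y).const_mul ((j:ℝ)+1))
    have e := h1.congr_of_eventuallyEq (Filter.Eventually.of_forall fun z => (ih z).symm)
    have := e.unique h2
    push_cast
    simp only [add_assoc] at this ⊢
    norm_num at this ⊢
    linarith

theorem stmt14 (d : ℕ) (hd : 2 ≤ d) (m n : ℕ) (hmn : m ≤ n)
    (g : ℝ → ℝ)
    (hg : ∀ t : ℝ, g t = laguerre (2 * (m : ℝ) + d - 2) (n - m) t * t ^ m) :
    ∀ t : ℝ, 0 < t →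
      t * deriv (deriv g) t + ((d : ℝ) - 1 - t) * deriv g t
        - (m : ℝ) * ((m : ℝ) + d - 2) * t⁻¹ * g t
      = -(n : ℝ) * g t := by
  obtain ⟨e, rfl⟩ := Nat.exists_eq_add_of_le hd
  obtain ⟨k, rfl⟩ := Nat.exists_eq_add_of_le hmn
  set w : ℝ → ℝ := fun y => y ^ (k + (2*m+e)) * Real.exp (-y) with hwdef
  have hw : ContDiff ℝ ⊤ w := by fun_prop
  have hD := lag_hasDeriv w hw
  have h0 : ∀ y, y * iteratedDeriv 1 w y
      = (((k + (2*m+e) : ℕ) : ℝ) - y) * iteratedDeriv 0 w y := by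
    intro y
    have h := (hasDerivAt_pow (k + (2*m+e)) y).mul ((hasDerivAt_id' y).neg.exp)
    have h' := (hD 0 y)
    rw [iteratedDeriv_zero] at h' ⊢
    have := h'.unique h
    simp only [zero_add] at this
    rw [this, hwdef]
    generalize k + (2*m+e) = N
    cases N with
    | zero => simp
    | succ N => simp [pow_succ]; ring
  have ode := lag_ode _ (fun j => iteratedDeriv j w) hD h0 k
  have hu := hD k
  have hu' := hD (k+1)
  set u := iteratedDeriv k w
  set u' := iteratedDeriv (k+1) w
  have hgf : ∀ t : ℝ, 0 < t → g t = (k.factorial : ℝ)⁻¹ * (t ^ (m+e))⁻¹ * Real.exp t * u t := by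
    intro t ht
    rw [hg, laguerre]
    have e1 : m + k - m = k := by omega
    have e2 : (2 * (m:ℝ) + ((2+e:ℕ):ℝ) - 2) = ((2*m+e : ℕ):ℝ) := by push_cast; ring
    rw [e1, e2]
    have e3 : (fun y : ℝ => y ^ ((k:ℝ) + ((2*m+e : ℕ):ℝ)) * Real.exp (-y)) = w := by
      funext y
      rw [← Nat.cast_add, Real.rpow_natCast]
    rw [e3, Real.rpow_neg ht.le, Real.rpow_natCast]
    have : t ^ (2*m+e) = t^(m+e) * t^m := by ring
    rw [this]
    field_simp
    rfl
  have hP : ∀ t : ℝ, 0 < t → HasDerivAt (fun t : ℝ => (k.factorial : ℝ)⁻¹ * (t ^ (m+e))⁻¹ * Real.exp t)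
      ((k.factorial : ℝ)⁻¹ * (t ^ (m+e))⁻¹ * Real.exp t * (1 - (m+e) * t⁻¹)) t := by
    intro t ht
    have h := (((hasDerivAt_pow (m+e) t).inv (by positivity)).const_mul (k.factorial : ℝ)⁻¹).mul
      (Real.hasDerivAt_exp t)
    refine h.congr_deriv ?_
    rw [← Nat.cast_add]
    generalize m + e = N
    cases N with
    | zero => simp
    | succ N => 
      simp only [Nat.add_sub_cancel, Pi.inv_apply, Pi.pow_apply]
      field_simp
      ring
  have hg1 : ∀ t : ℝ, 0 < t → HasDerivAt g ((k.factorial : ℝ)⁻¹ * (t ^ (m+e))⁻¹ * Real.exp t *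
      ((1 - (m+e) * t⁻¹) * u t + u' t)) t := by
    intro t ht
    refine (((hP t ht).mul (hu t)).congr_of_eventuallyEq ?_).congr_deriv (by ring)
    filter_upwards [lt_mem_nhds ht] with s hs using hgf s hs
  intro t ht
  have hg2 : HasDerivAt (deriv g) _ t :=
    ((hP t ht).mul (((((hasDerivAt_inv ht.ne').const_mul ((m:ℝ)+e)).const_sub 1).mul (hu t)).add
      (hu' t))).congr_of_eventuallyEq (by
        filter_upwards [lt_mem_nhds ht] with s hs using (hg1 s hs).deriv)
  rw [hg2.deriv, (hg1 t ht).deriv, hgf t ht]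
  have o := ode t
  simp only [Pi.add_apply, Pi.mul_apply]
  push_cast at o ⊢
  generalize (k.factorial : ℝ)⁻¹ * (t ^ (m+e))⁻¹ * Real.exp t = P
  have o2 : t * iteratedDeriv (k + 1 + 1) w t = (k + (2*m+e) - t) * u' t - (k+1) * u t - (k+1) * u' t := by
    linear_combination o
  generalize iteratedDeriv (k + 1 + 1) w t = u2 at *
  have o3 : u2 = ((k + (2*m+e) - t) * u' t - (k+1) * u t - (k+1) * u' t) / t := by
    rw [← o2]; field_simp
  rw [o3]
  field_simp
  ring
end

section
/- Let d ≥ 2 be an integer, let m ≤ n and m′ ≤ n′ be natural numbers, and let p be a real number with p > 2·max(n,n′) + d. Let Y and Y′ be spherical harmonics of degrees m and m′ respectively. Set b_p := 1/(ω_d Γ(p−d)). Then b_p · ∫_0^∞ ( ∫_{S^{d−1}} N_{n−m}^{(p−2m−d+1)}(t) Y(tξ) · N_{n′−m′}^{(p−2m′−d+1)}(t) Y′(tξ) dσ(ξ) ) t^{d−1−p} e^{−1/t} dt equals [ (n−m)! Γ(p−n−m−d+1) / ( (p−2n−d) Γ(p−d) ) ] · ( (1/ω_d) ∫_{S^{d−1}}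 Y(ξ)Y′(ξ) dσ(ξ) ) if n = n′ and m = m′, and equals 0 otherwise. -/
open MeasureTheory Real

/-- Second-class finite orthogonal polynomial `N_n^{(p)}` defined via the Rodrigues formula. -/
noncomputable def finiteN (p : ℝ) (n : ℕ) (x : ℝ) : ℝ :=
  (-1 : ℝ) ^ n * x ^ p * Real.exp (1 / x) *
    iteratedDeriv n (fun y : ℝ => y ^ (2 * (n : ℝ) - p) * Real.exp (-1 / y)) x

/-- The surface area `ω_d = 2 π^{d/2} / Γ(d/2)` of the unit sphere `S^{d-1}`. -/
noncomputable def omegaSphere (d : ℕ) : ℝ :=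
  2 * Real.pi ^ ((d : ℝ) / 2) / Real.Gamma ((d : ℝ) / 2)

/-- The surface measure on the unit sphere `S^{d-1} ⊆ ℝ^d`. -/
noncomputable def sphereMeasure (d : ℕ) :
    Measure (Metric.sphere (0 : EuclideanSpace ℝ (Fin d)) 1) :=
  (volume : Measure (EuclideanSpace ℝ (Fin d))).toSphere

lemma moment_congr (a : ℝ) : ∀ x ∈ Set.Ioi (0:ℝ), x ^ a * Real.exp (-1 / x) =
    (|(-1:ℝ)| * x ^ ((-1:ℝ) - 1)) • (fun u : ℝ => Real.exp (-u) * u ^ ((-a-1) - 1)) (x ^ (-1:ℝ)) := by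
  intro x hx
  have hx : 0 < x := hx
  simp only [smul_eq_mul, abs_neg, abs_one, one_mul]
  rw [← Real.rpow_mul hx.le, mul_left_comm, ← Real.rpow_add hx, mul_comm, Real.rpow_neg_one]
  congr 2
  · ring
  · ring

lemma moment_integrable {a : ℝ} (ha : a < -1) :
    IntegrableOn (fun x : ℝ => x ^ a * Real.exp (-1 / x)) (Set.Ioi 0) := by
  rw [integrableOn_congr_fun (moment_congr a) measurableSet_Ioi,
    integrableOn_Ioi_comp_rpow_iff (fun u : ℝ => Real.exp (-u) * u ^ ((-a-1) - 1)) (by norm_num : (-1:ℝ) ≠ 0)]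
  exact Real.GammaIntegral_convergent (by linarith)

lemma moment_eq {a : ℝ} (ha : a < -1) :
    ∫ x in Set.Ioi (0:ℝ), x ^ a * Real.exp (-1 / x) = Real.Gamma (-a-1) := by
  rw [setIntegral_congr_fun measurableSet_Ioi (moment_congr a),
    integral_comp_rpow_Ioi (fun u : ℝ => Real.exp (-u) * u ^ ((-a-1) - 1)) (by norm_num : (-1:ℝ) ≠ 0), Real.Gamma_eq_integral (by linarith)]

/-- integral of a polynomial against `x^a e^{-1/x}` -/
noncomputable def Jint (a : ℝ) (Q : Polynomial ℝ) : ℝ :=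
  ∫ x in Set.Ioi (0:ℝ), Q.eval x * (x ^ a * Real.exp (-1 / x))

lemma J_mon_congr (a c : ℝ) (j : ℕ) : ∀ x ∈ Set.Ioi (0:ℝ),
    (Polynomial.monomial j c).eval x * (x ^ a * Real.exp (-1 / x)) =
    c * (x ^ (a + j) * Real.exp (-1 / x)) := by
  intro x hx
  have hx : 0 < x := hx
  rw [Polynomial.eval_monomial, Real.rpow_add hx, Real.rpow_natCast]; ring

lemma J_integrable {a : ℝ} (Q : Polynomial ℝ) (h : Q.natDegree + a < -1) :
    IntegrableOn (fun x : ℝ => Q.eval x * (x ^ a * Real.exp (-1 / x))) (Set.Ioi 0) := by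
  have : (fun x : ℝ => Q.eval x * (x ^ a * Real.exp (-1 / x))) = fun x =>
      ∑ j ∈ Finset.range (Q.natDegree + 1),
        (Polynomial.monomial j (Q.coeff j)).eval x * (x ^ a * Real.exp (-1 / x)) := by
    funext x
    conv_lhs => rw [Q.as_sum_range]
    rw [Polynomial.eval_finsetSum, Finset.sum_mul]
  rw [this]
  refine MeasureTheory.integrable_finsetSum _ fun j hj => ?_
  have hj : (j:ℝ) ≤ Q.natDegree := by
    exact_mod_cast Nat.lt_succ_iff.mp (Finset.mem_range.mp hj)
  have := (moment_integrable (a := a + j) (by linarith)).const_mul (Q.coeff j)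
  exact (integrableOn_congr_fun (J_mon_congr a (Q.coeff j) j) measurableSet_Ioi).mpr this

lemma J_monomial (a c : ℝ) (j : ℕ) (h : j + a < -1) :
    Jint a (Polynomial.monomial j c) = c * Real.Gamma (-a-j-1) := by
  unfold Jint
  rw [setIntegral_congr_fun measurableSet_Ioi (J_mon_congr a c j), integral_const_mul,
    moment_eq (by linarith)]
  congr 2; ring

lemma J_add {a : ℝ} (P Q : Polynomial ℝ) (hP : P.natDegree + a < -1) (hQ : Q.natDegree + a < -1) :
    Jint a (P + Q) = Jint a P + Jint a Q := by
  unfold Jint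
  rw [← integral_add (J_integrable P hP) (J_integrable Q hQ)]
  simp only [Polynomial.eval_add, add_mul]

lemma J_zero (a : ℝ) : Jint a 0 = 0 := by simp [Jint]

lemma J_neg (a : ℝ) (P : Polynomial ℝ) : Jint a (-P) = - Jint a P := by
  simp [Jint, integral_neg]

noncomputable def Tpol (a : ℝ) (P : Polynomial ℝ) : Polynomial ℝ :=
  Polynomial.X ^ 2 * P.derivative + (Polynomial.C a * Polynomial.X + 1) * P

lemma Tpol_add (a : ℝ) (P Q : Polynomial ℝ) : Tpol a (P + Q) = Tpol a P + Tpol a Q := by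
  simp [Tpol]; ring

lemma Tpol_monomial (a c : ℝ) (j : ℕ) : Tpol a (Polynomial.monomial j c) =
    Polynomial.monomial (j+1) ((j + a) * c) + Polynomial.monomial j c := by
  simp only [Tpol, ← Polynomial.C_mul_X_pow_eq_monomial, Polynomial.derivative_mul,
    Polynomial.derivative_C, Polynomial.derivative_X_pow, zero_mul, zero_add, Polynomial.C_mul,
    Polynomial.C_add]
  cases j with
  | zero => simp; ring
  | succ j => simp; ring

lemma Tpol_natDegree (a : ℝ) (P : Polynomial ℝ) : (Tpol a P).natDegree ≤ P.natDegree + 1 := by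
  refine Polynomial.induction_with_natDegree_le
    (motive := fun Q => (Tpol a Q).natDegree ≤ P.natDegree + 1) P.natDegree ?_ ?_ ?_ P le_rfl
  · simp [Tpol]
  · intro n r hr hn
    rw [Polynomial.C_mul_X_pow_eq_monomial, Tpol_monomial]
    refine (Polynomial.natDegree_add_le _ _).trans (max_le ?_ ?_)
    · exact (Polynomial.natDegree_monomial_le _).trans (by omega)
    · exact (Polynomial.natDegree_monomial_le _).trans (by omega)
  · intro f g _ _ hf hg
    rw [Tpol_add]
    exact (Polynomial.natDegree_add_le _ _).trans (max_le hf hg)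

lemma J_Tpol (a : ℝ) (R : Polynomial ℝ) (h : R.natDegree + a < 0) :
    Jint (a - 2) (Tpol a R) = 0 := by
  refine Polynomial.induction_with_natDegree_le
    (motive := fun Q => Jint (a-2) (Tpol a Q) = 0) R.natDegree ?_ ?_ ?_ R le_rfl
  · simp [Tpol, J_zero]
  · intro n r hr hn
    have hn : (n:ℝ) ≤ R.natDegree := by exact_mod_cast hn
    have e1 : ((Polynomial.monomial (n+1) ((n + a) * r)).natDegree : ℝ) ≤ n + 1 := by
      exact_mod_cast Polynomial.natDegree_monomial_le _
    have e2 : ((Polynomial.monomial n r).natDegree : ℝ) ≤ n := by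
      exact_mod_cast Polynomial.natDegree_monomial_le _
    rw [Polynomial.C_mul_X_pow_eq_monomial, Tpol_monomial, J_add _ _ (by linarith) (by linarith),
      J_monomial _ _ _ (by push_cast; linarith), J_monomial _ _ _ (by linarith)]
    have := Real.Gamma_add_one (s := -a - n) (by linarith)
    push_cast
    rw [show -(a-2) - (n:ℝ) - 1 = -a - n + 1 by ring, this,
      show -(a-2) - ((n:ℝ)+1) - 1 = -a - n by ring]
    ring
  · intro f g hf hg hf' hg'
    have e1 : ((Tpol a f).natDegree : ℝ) ≤ R.natDegree + 1 := by
      exact_mod_cast (Tpol_natDegree a f).trans (by omega)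
    have e2 : ((Tpol a g).natDegree : ℝ) ≤ R.natDegree + 1 := by
      exact_mod_cast (Tpol_natDegree a g).trans (by omega)
    rw [Tpol_add, J_add _ _ (by linarith) (by linarith), hf', hg', add_zero]

lemma J_mul_X2 (a : ℝ) (P : Polynomial ℝ) : Jint (a-2) (Polynomial.X ^ 2 * P) = Jint a P := by
  unfold Jint
  refine setIntegral_congr_fun measurableSet_Ioi fun x hx => ?_
  have hx : 0 < x := hx
  have : x ^ a = x ^ 2 * x ^ (a-2) := by
    rw [← Real.rpow_natCast, ← Real.rpow_add hx]; congr 1; push_cast; ring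
  simp only [Polynomial.eval_mul, Polynomial.eval_pow, Polynomial.eval_X]
  rw [this]; ring

lemma J_parts (a : ℝ) (P Q : Polynomial ℝ) (h : (Q.natDegree : ℝ) + P.natDegree + a < 0) :
    Jint (a-2) (Q * Tpol a P) = - Jint a (Q.derivative * P) := by
  have h0 : ((Q * P).natDegree : ℝ) ≤ Q.natDegree + P.natDegree := by
    exact_mod_cast Polynomial.natDegree_mul_le
  have h1 : ((Tpol a (Q*P)).natDegree : ℝ) ≤ Q.natDegree + P.natDegree + 1 := by
    have := Tpol_natDegree a (Q*P)
    have h2 := Polynomial.natDegree_mul_le (p := Q) (q := P)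
    exact_mod_cast this.trans (by omega)
  by_cases hQ : Q.natDegree = 0
  · rw [Polynomial.eq_C_of_natDegree_eq_zero hQ]
    have := J_Tpol a (Q*P) (by linarith)
    rw [Polynomial.eq_C_of_natDegree_eq_zero hQ] at this
    simp only [Polynomial.derivative_C, zero_mul, J_zero, neg_zero]
    rw [← this]; congr 1; simp [Tpol]; ring
  have h3 : ((Polynomial.X ^ 2 * -(Q.derivative * P)).natDegree : ℝ) ≤
      Q.natDegree + P.natDegree + 1 := by
    have e1 := Polynomial.natDegree_mul_le (p := (Polynomial.X ^ 2 : Polynomial ℝ))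
      (q := -(Q.derivative * P))
    have e2 := Polynomial.natDegree_mul_le (p := Q.derivative) (q := P)
    have e3 := Polynomial.natDegree_derivative_le Q
    rw [Polynomial.natDegree_neg, Polynomial.natDegree_X_pow] at e1
    exact_mod_cast e1.trans (by omega)
  have e : Q * Tpol a P = Tpol a (Q * P) + Polynomial.X ^ 2 * -(Q.derivative * P) := by
    simp [Tpol]; ring
  rw [e, J_add _ _ (by linarith) (by linarith), J_Tpol a _ (by linarith), J_mul_X2, J_neg, zero_add]

/-- `P_j` for the exponent `b`. -/
noncomputable def Ppol (b : ℝ) : ℕ → Polynomial ℝ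
  | 0 => 1
  | j+1 => Tpol (b - 2 * j) (Ppol b j)

lemma Ppol_natDegree (b : ℝ) (j : ℕ) : (Ppol b j).natDegree ≤ j := by
  induction j with
  | zero => simp [Ppol]
  | succ j ih => exact (Tpol_natDegree _ _).trans (by omega)

lemma Tpol_coeff (a : ℝ) (P : Polynomial ℝ) (j : ℕ) (h : P.natDegree ≤ j) :
    (Tpol a P).coeff (j+1) = (j + a) * P.coeff j := by
  have h0 : P.coeff (j+1) = 0 := Polynomial.coeff_eq_zero_of_natDegree_lt (by omega)
  have : Tpol a P = Polynomial.X * (Polynomial.X * P.derivative) +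
    (Polynomial.C a * (Polynomial.X * P) + P) := by simp [Tpol]; ring
  rw [this]
  simp only [Polynomial.coeff_add, Polynomial.coeff_X_mul, Polynomial.coeff_C_mul, h0]
  cases j with
  | zero => simp
  | succ j => simp [Polynomial.coeff_X_mul, Polynomial.coeff_derivative]; ring

lemma Ppol_coeff (b : ℝ) (j : ℕ) : (-1) ^ j * (Ppol b j).coeff j * Real.Gamma (-b) = Real.Gamma (-b + j) ∨
    ¬ b < 0 := by
  by_cases hb : b < 0
  swap
  · exact Or.inr hb
  left
  induction j with
  | zero => simp [Ppol]
  | succ j ih =>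
    have hj : (0:ℝ) ≤ j := Nat.cast_nonneg j
    rw [Ppol, Tpol_coeff _ _ _ (Ppol_natDegree b j)]
    push_cast
    rw [← add_assoc, Real.Gamma_add_one (by linarith), ← ih]; ring

lemma J_iter (b : ℝ) (j : ℕ) : ∀ Q : Polynomial ℝ, (Q.natDegree : ℝ) + b - j < -1 →
    Jint (b - 2 * j) (Q * Ppol b j) = (-1) ^ j * Jint b (Polynomial.derivative^[j] Q) := by
  induction j with
  | zero => intro Q _; simp [Ppol]
  | succ j ih =>
    intro Q hQ
    have hd : ((Ppol b j).natDegree : ℝ) ≤ j := by exact_mod_cast Ppol_natDegree b j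
    push_cast at hQ ⊢
    rw [Ppol, show b - 2 * ((j:ℝ)+1) = (b - 2 * j) - 2 by ring, J_parts _ _ _ (by linarith)]
    by_cases h0 : Q.natDegree = 0
    · rw [Polynomial.eq_C_of_natDegree_eq_zero h0]
      simp [J_zero]
    · have := Polynomial.natDegree_derivative_le Q
      have : (Q.derivative.natDegree : ℝ) + 1 ≤ Q.natDegree := by exact_mod_cast (by omega)
      rw [ih _ (by linarith), Function.iterate_succ_apply]; ring

lemma hasDeriv_G (a : ℝ) (P : Polynomial ℝ) {x : ℝ} (hx : 0 < x) :
    HasDerivAt (fun y : ℝ => P.eval y * (y ^ a * Real.exp (-1 / y)))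
      ((Tpol a P).eval x * (x ^ (a-2) * Real.exp (-1/x))) x := by
  have h1 := P.hasDerivAt x
  have h2 := Real.hasDerivAt_rpow_const (x := x) (p := a) (Or.inl hx.ne')
  have h3 : HasDerivAt (fun y : ℝ => Real.exp (-1 / y)) (Real.exp (-1/x) * (1 / x^2)) x := by
    have := ((hasDerivAt_inv hx.ne').neg).exp
    convert this using 1
    · funext y; simp [neg_div]
    · simp [neg_div]
  refine (h1.mul (h2.mul h3)).congr_deriv ?_
  have e1 : x ^ a = x ^ 2 * x ^ (a-2) := by
    rw [← Real.rpow_natCast, ← Real.rpow_add hx]; congr 1; push_cast; ring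
  have e2 : x ^ (a-1) = x * x ^ (a-2) := by
    nth_rw 2 [← Real.rpow_one x]
    rw [← Real.rpow_add hx]; congr 1; ring
  simp only [Pi.mul_apply]
  rw [e1, e2]
  simp only [Tpol, Polynomial.eval_add, Polynomial.eval_mul, Polynomial.eval_pow, Polynomial.eval_X,
    Polynomial.eval_C, Polynomial.eval_one]
  generalize x ^ (a-2) = z
  field_simp

lemma iteratedDeriv_G (b : ℝ) (j : ℕ) : ∀ x : ℝ, 0 < x →
    iteratedDeriv j (fun y : ℝ => y ^ b * Real.exp (-1 / y)) x =
      (Ppol b j).eval x * (x ^ (b - 2 * j) * Real.exp (-1/x)) := by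
  induction j with
  | zero => intro x hx; simp [Ppol]
  | succ j ih =>
    intro x hx
    rw [iteratedDeriv_succ]
    have : iteratedDeriv j (fun y : ℝ => y ^ b * Real.exp (-1 / y)) =ᶠ[nhds x]
      fun x => (Ppol b j).eval x * (x ^ (b - 2 * j) * Real.exp (-1/x)) := by
      filter_upwards [Ioi_mem_nhds hx] with y hy using ih y hy
    rw [this.deriv_eq, (hasDeriv_G _ _ hx).deriv, Ppol]
    push_cast
    congr 3; ring

lemma finiteN_eq (q : ℝ) (n : ℕ) {x : ℝ} (hx : 0 < x) :
    finiteN q n x = (-1) ^ n * (Ppol (2 * n - q) n).eval x := by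
  rw [finiteN, iteratedDeriv_G _ _ x hx]
  have e1 : x ^ q * x ^ (2 * (n:ℝ) - q - 2 * n) = 1 := by
    rw [← Real.rpow_add hx]; simp
  have e2 : Real.exp (1/x) * Real.exp (-1/x) = 1 := by
    rw [← Real.exp_add]; simp [neg_div]
  linear_combination ((-1) ^ n * (Ppol (2 * n - q) n).eval x) * 
    (e1 * Real.exp (1/x) * Real.exp (-1/x) + e2)

lemma orth_line (q : ℝ) (k k' : ℕ) (hq : 2 * ((max k k' : ℕ) : ℝ) + 1 < q) :
    ∫ x in Set.Ioi (0:ℝ), finiteN q k x * finiteN q k' x * (x ^ (-q) * Real.exp (-1/x)) =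
    if k = k' then k.factorial * Real.Gamma (q - k) / (q - 2 * k - 1) else 0 := by
  wlog h : k' ≤ k generalizing k k'
  · have := this k' k (by rwa [max_comm]) (by omega)
    rw [if_neg (by omega)] at this ⊢
    refine Eq.trans ?_ this
    congr 1; funext x; ring
  rw [max_eq_left h] at hq
  have hkk : (k':ℝ) ≤ k := by exact_mod_cast h
  have e : ∫ x in Set.Ioi (0:ℝ), finiteN q k x * finiteN q k' x * (x ^ (-q) * Real.exp (-1/x)) =
      (-1) ^ (k + k') * Jint ((2 * k - q) - 2 * k) (Ppol (2 * k' - q) k' * Ppol (2 * k - q) k) := by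
    rw [Jint, ← integral_const_mul]
    refine setIntegral_congr_fun measurableSet_Ioi fun x hx => ?_
    have hx : 0 < x := hx
    simp only [finiteN_eq q _ hx, Polynomial.eval_mul]
    rw [show 2 * (k:ℝ) - q - 2 * k = -q by ring]
    ring
  have hd : ((Ppol (2 * k' - q) k').natDegree : ℝ) ≤ k' := by exact_mod_cast Ppol_natDegree _ k'
  rw [e, J_iter _ _ _ (by linarith)]
  split_ifs with hk
  · subst hk
    have hP : Polynomial.derivative^[k] (Ppol (2 * k - q) k) =
        Polynomial.monomial 0 (k.factorial * (Ppol (2 * k - q) k).coeff k) := by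
      ext i
      rw [Polynomial.coeff_iterate_derivative, Polynomial.coeff_monomial]
      split_ifs with hi
      · subst hi; simp [Nat.descFactorial_self]
      · rw [Polynomial.coeff_eq_zero_of_natDegree_lt
          ((Ppol_natDegree _ _).trans_lt (by omega)), smul_zero]
    have hc := (Ppol_coeff (2 * k - q) k).resolve_right (by push Not; linarith)
    rw [hP, J_monomial _ _ _ (by push_cast; linarith)]
    rw [show -(2 * (k:ℝ) - q) = (q - 2 * k - 1) + 1 by ring, Real.Gamma_add_one (by linarith)] at hc
    rw [show q - 2 * (k:ℝ) - 1 + 1 + k = q - k by ring] at hc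
    rw [← hc, eq_div_iff (by linarith), show -(2 * (k:ℝ) - q) - ((0:ℕ):ℝ) - 1 = q - 2 * k - 1 by
      push_cast; ring, ← two_mul, pow_mul]
    simp; ring
  · rw [Polynomial.iterate_derivative_eq_zero ((Ppol_natDegree _ _).trans_lt (by omega)), J_zero]
    simp

/-- evaluation of a polynomial at a point of Euclidean space -/
noncomputable def evE {d : ℕ} (P : MvPolynomial (Fin d) ℝ) (x : EuclideanSpace ℝ (Fin d)) : ℝ :=
  MvPolynomial.eval (fun i => x i) P

lemma evE_continuous {d : ℕ} (P : MvPolynomial (Fin d) ℝ) : Continuous (evE P) :=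
  (MvPolynomial.continuous_eval P).comp (by fun_prop)

lemma hom_eval {d m : ℕ} {P : MvPolynomial (Fin d) ℝ} (hP : P.IsHomogeneous m) (t : ℝ)
    (x : Fin d → ℝ) :
    MvPolynomial.eval (fun i => t * x i) P = t ^ m * MvPolynomial.eval x P := by
  rw [MvPolynomial.eval_eq, MvPolynomial.eval_eq, Finset.mul_sum]
  refine Finset.sum_congr rfl fun s hs => ?_
  have : s.degree = m := by
    have := hP (MvPolynomial.mem_support_iff.mp hs)
    rw [Finsupp.degree_eq_weight_one]; exact this
  simp only [mul_pow, Finset.prod_mul_distrib]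
  have h2 : ∏ i ∈ s.support, t ^ s i = t ^ m := by
    rw [Finset.prod_pow_eq_pow_sum]; congr 1
  rw [h2]; ring

lemma evE_bound {d : ℕ} (P : MvPolynomial (Fin d) ℝ) :
    ∀ c : ℝ, 0 < c → ∃ C : ℝ, 0 ≤ C ∧ ∀ x, |evE P x| ≤ C * Real.exp (c * ‖x‖ ^ 2) := by
  induction P using MvPolynomial.induction_on with
  | C a =>
    intro c hc
    refine ⟨|a|, abs_nonneg _, fun x => ?_⟩
    simp only [evE, MvPolynomial.eval_C]
    have : 1 ≤ Real.exp (c * ‖x‖^2) := Real.one_le_exp (by positivity)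
    nlinarith [abs_nonneg a]
  | add p q hp hq =>
    intro c hc
    obtain ⟨C1, h1, hp⟩ := hp c hc
    obtain ⟨C2, h2, hq⟩ := hq c hc
    refine ⟨C1 + C2, by positivity, fun x => ?_⟩
    have : evE (p+q) x = evE p x + evE q x := by simp [evE]
    rw [this, add_mul]
    exact (abs_add_le _ _).trans (add_le_add (hp x) (hq x))
  | mul_X p i hp =>
    intro c hc
    obtain ⟨C1, h1, hp⟩ := hp (c/2) (by positivity)
    refine ⟨C1 * (1 + 2 / c), by positivity, fun x => ?_⟩
    have : evE (p * MvPolynomial.X i) x = evE p x * x i := by simp [evE]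
    rw [this, abs_mul]
    have hx : |x i| ≤ ‖x‖ := by simpa using PiLp.norm_apply_le x i
    have h3 : ‖x‖ ≤ (1 + 2/c) * Real.exp (c/2 * ‖x‖^2) := by
      have e1 : c/2 * ‖x‖^2 + 1 ≤ Real.exp (c/2 * ‖x‖^2) := Real.add_one_le_exp _
      have e2 : (1 + 2/c) * (c/2 * ‖x‖^2 + 1) ≤ (1 + 2/c) * Real.exp (c/2 * ‖x‖^2) := by gcongr
      have e3 : (1 + 2/c) * (c/2 * ‖x‖^2 + 1) = c/2 * ‖x‖^2 + 1 + ‖x‖^2 + 2/c := by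
        field_simp; ring
      have : 0 < 2/c := by positivity
      have : 0 ≤ c/2 * ‖x‖^2 := by positivity
      nlinarith [sq_nonneg (‖x‖ - 1)]
    calc |evE p x| * |x i| ≤ (C1 * Real.exp (c/2 * ‖x‖^2)) * ((1 + 2/c) * Real.exp (c/2 * ‖x‖^2)) :=
          mul_le_mul (hp x) (hx.trans h3) (abs_nonneg _) (by positivity)
      _ = C1 * (1 + 2/c) * (Real.exp (c/2 * ‖x‖^2) * Real.exp (c/2 * ‖x‖^2)) := by ring
      _ = _ := by rw [← Real.exp_add]; congr 2; ring

lemma gauss_integrable {d : ℕ} (P : MvPolynomial (Fin d) ℝ) :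
    Integrable (fun x : EuclideanSpace ℝ (Fin d) => evE P x * Real.exp (-‖x‖^2)) := by
  obtain ⟨C, hC, h⟩ := evE_bound P (1/2) (by norm_num)
  have hg : Integrable (fun x : EuclideanSpace ℝ (Fin d) => Real.exp (-(1/2) * ‖x‖^2)) := by
    have := (GaussianFourier.integrable_cexp_neg_mul_sq_norm_add (V := EuclideanSpace ℝ (Fin d))
      (b := (1/2 : ℂ)) (by norm_num) 0 0).norm
    refine this.congr (Filter.Eventually.of_forall fun x => ?_)
    simp only [Complex.norm_exp]
    congr 1
    simp [← Complex.ofReal_pow]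
  refine (hg.const_mul C).mono' ?_ (Filter.Eventually.of_forall fun x => ?_)
  · exact ((evE_continuous P).mul (by fun_prop)).aestronglyMeasurable
  · rw [Real.norm_eq_abs, abs_mul, Real.abs_exp]
    calc |evE P x| * Real.exp (-‖x‖^2) ≤ (C * Real.exp (1/2 * ‖x‖^2)) * Real.exp (-‖x‖^2) := by
          gcongr; exact h x
      _ = C * (Real.exp (1/2 * ‖x‖^2) * Real.exp (-‖x‖^2)) := by ring
      _ = _ := by rw [← Real.exp_add]; congr 2; ring

lemma evE_lineDeriv {d : ℕ} (P : MvPolynomial (Fin d) ℝ) (i : Fin d)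
    (x : EuclideanSpace ℝ (Fin d)) :
    HasLineDerivAt ℝ (evE P) (evE (MvPolynomial.pderiv i P) x) x (EuclideanSpace.single i (1:ℝ)) := by
  unfold HasLineDerivAt
  induction P using MvPolynomial.induction_on with
  | C a => simpa [evE] using hasDerivAt_const (0:ℝ) a
  | add p q hp hq => simpa [evE] using! hp.add hq
  | mul_X p j hp =>
    have hx : HasDerivAt (fun t : ℝ => (x + t • EuclideanSpace.single i (1:ℝ)) j)
        (if j = i then 1 else 0) 0 := by
      have := ((hasDerivAt_id (0:ℝ)).mul_const (if j = i then (1:ℝ) else 0)).const_add (x j)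
      simpa [Pi.single_apply] using! this
    have h2 := hp.mul hx
    have e : (fun t : ℝ => evE (p * MvPolynomial.X j) (x + t • EuclideanSpace.single i (1:ℝ))) =
      fun t : ℝ => evE p (x + t • EuclideanSpace.single i (1:ℝ)) *
        (x + t • EuclideanSpace.single i (1:ℝ)) j := by
      funext t; simp [evE]
    rw [e]
    refine h2.congr_deriv ?_
    simp [evE, MvPolynomial.pderiv_X, Pi.single_apply]
    split_ifs with h1 <;> simp_all <;> ring

lemma gauss_lineDeriv {d : ℕ} (i : Fin d) (x : EuclideanSpace ℝ (Fin d)) :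
    HasLineDerivAt ℝ (fun y : EuclideanSpace ℝ (Fin d) => Real.exp (-‖y‖^2))
      (-2 * x i * Real.exp (-‖x‖^2)) x (EuclideanSpace.single i (1:ℝ)) := by
  have h := ((hasStrictFDerivAt_norm_sq x).hasFDerivAt.neg.exp).hasLineDerivAt
    (EuclideanSpace.single i (1:ℝ))
  have e : (Real.exp ((-fun x => ‖x‖ ^ 2) x) • -(2 • (innerSL ℝ) x)) (EuclideanSpace.single i 1) =
      -2 * x i * Real.exp (-‖x‖^2) := by
    simp [EuclideanSpace.inner_single_right]
    ring
  rw [e] at h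
  exact h

/-- Gaussian integral of a polynomial -/
noncomputable def gI {d : ℕ} (P : MvPolynomial (Fin d) ℝ) : ℝ :=
  ∫ x : EuclideanSpace ℝ (Fin d), evE P x * Real.exp (-‖x‖^2)

lemma gI_add {d : ℕ} (P Q : MvPolynomial (Fin d) ℝ) : gI (P + Q) = gI P + gI Q := by
  unfold gI
  rw [← integral_add (gauss_integrable P) (gauss_integrable Q)]
  simp [evE, add_mul]

lemma gI_sum {d : ℕ} (f : Fin d → MvPolynomial (Fin d) ℝ) : gI (∑ i, f i) = ∑ i, gI (f i) := by
  unfold gI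
  rw [← integral_finsetSum _ fun i _ => gauss_integrable (f i)]
  simp [evE, Finset.sum_mul]

lemma gI_nsmul {d : ℕ} (m : ℕ) (P : MvPolynomial (Fin d) ℝ) : gI (m • P) = m * gI P := by
  unfold gI
  rw [← integral_const_mul]
  simp [evE, mul_assoc]

lemma gI_parts {d : ℕ} (P : MvPolynomial (Fin d) ℝ) (i : Fin d) :
    2 * gI (MvPolynomial.X i * P) = gI (MvPolynomial.pderiv i P) := by
  have h0 : (fun x : EuclideanSpace ℝ (Fin d) => evE P x * (-2 * x i * Real.exp (-‖x‖^2))) =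
      fun x => -2 * (evE (MvPolynomial.X i * P) x * Real.exp (-‖x‖^2)) := by
    funext x; simp [evE]; ring
  have key := integral_bilinear_hasLineDerivAt_right_eq_neg_left_of_integrable
    (μ := (volume : Measure (EuclideanSpace ℝ (Fin d))))
    (f := evE P) (f' := evE (MvPolynomial.pderiv i P))
    (g := fun y : EuclideanSpace ℝ (Fin d) => Real.exp (-‖y‖^2))
    (g' := fun x => -2 * x i * Real.exp (-‖x‖^2)) (v := EuclideanSpace.single i (1:ℝ))
    (B := ContinuousLinearMap.mul ℝ ℝ)
    (by simpa using gauss_integrable (MvPolynomial.pderiv i P))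
    (by
      simp only [ContinuousLinearMap.mul_apply']
      rw [h0]
      exact (gauss_integrable _).const_mul _)
    (by simpa using gauss_integrable P)
    (fun x _ => evE_lineDeriv P i x) (fun x _ => gauss_lineDeriv i x)
  simp only [ContinuousLinearMap.mul_apply'] at key
  rw [h0, integral_const_mul] at key
  unfold gI
  linarith

lemma gI_euler {d m : ℕ} {Y Z : MvPolynomial (Fin d) ℝ} (hY : IsSphericalHarmonic d m Y) :
    2 * (m * gI (Y * Z)) = gI (∑ i, MvPolynomial.pderiv i Y * MvPolynomial.pderiv i Z) := by
  have e : m • (Y * Z) = ∑ i, MvPolynomial.X i * (MvPolynomial.pderiv i Y * Z) := by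
    rw [← smul_mul_assoc, ← hY.1.sum_X_mul_pderiv, Finset.sum_mul]
    simp only [mul_assoc]
  rw [← gI_nsmul, e, gI_sum, Finset.mul_sum]
  simp only [gI_parts]
  rw [← gI_sum]
  congr 1
  simp only [MvPolynomial.pderiv_mul, Finset.sum_add_distrib]
  rw [← Finset.sum_mul, hY.2, zero_mul, zero_add]

lemma gI_orth {d m m' : ℕ} {Y Y' : MvPolynomial (Fin d) ℝ} (hY : IsSphericalHarmonic d m Y)
    (hY' : IsSphericalHarmonic d m' Y') (h : m ≠ m') : gI (Y * Y') = 0 := by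
  have h1 := gI_euler (Z := Y') hY
  have h2 := gI_euler (Z := Y) hY'
  have h3 : ((m:ℝ) - m') * gI (Y * Y') = 0 := by
    rw [mul_comm Y' Y] at h2
    simp only [mul_comm (MvPolynomial.pderiv _ Y')] at h2
    linarith
  exact (mul_eq_zero.mp h3).resolve_left (sub_ne_zero.mpr (by exact_mod_cast h))

lemma gI_polar {d k : ℕ} (hd : 2 ≤ d) {P : MvPolynomial (Fin d) ℝ} (hP : P.IsHomogeneous k) :
    gI P = (∫ ξ : Metric.sphere (0 : EuclideanSpace ℝ (Fin d)) 1,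
      MvPolynomial.eval (fun i => (ξ : EuclideanSpace ℝ (Fin d)) i) P ∂(sphereMeasure d)) *
      ((1/2) * Real.Gamma (((d - 1 + k : ℕ) + 1 : ℝ) / 2)) := by
  have : Nontrivial (EuclideanSpace ℝ (Fin d)) := by
    have : Nonempty (Fin d) := ⟨⟨0, by omega⟩⟩
    infer_instance
  have : IsFiniteMeasure (sphereMeasure d) := by unfold sphereMeasure; infer_instance
  calc
    gI P = ∫ x : ({(0)}ᶜ : Set (EuclideanSpace ℝ (Fin d))), evE P x.1 * Real.exp (-‖x.1‖^2)
        ∂(volume.comap Subtype.val) := by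
      rw [integral_subtype_comap (measurableSet_singleton _).compl
        (fun x ↦ evE P x * Real.exp (-‖x‖^2)), restrict_compl_singleton, gI]
    _ = ∫ z, (MvPolynomial.eval (fun i => (z.1 : EuclideanSpace ℝ (Fin d)) i) P) *
          ((z.2:ℝ) ^ k * Real.exp (-(z.2:ℝ)^2))
          ∂(sphereMeasure d).prod (.volumeIoiPow (d - 1)) := by
      have := (volume : Measure (EuclideanSpace ℝ (Fin d))).measurePreserving_homeomorphUnitSphereProd.integral_comp
        (Homeomorph.measurableEmbedding _) (fun z => (MvPolynomial.eval (fun i => (z.1 : EuclideanSpace ℝ (Fin d)) i) P) *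
          ((z.2:ℝ) ^ k * Real.exp (-(z.2:ℝ)^2)))
      rw [finrank_euclideanSpace_fin] at this
      rw [sphereMeasure, ← this]
      congr 1; funext x
      have hx : ‖x.1‖ ≠ 0 := norm_ne_zero_iff.mpr x.2
      have h1 : evE P x.1 = ‖x.1‖ ^ k * MvPolynomial.eval
          (fun i => ((homeomorphUnitSphereProd _ x).1 : EuclideanSpace ℝ (Fin d)) i) P := by
        rw [← hom_eval hP]
        unfold evE; congr 2
        funext i
        simp [hx]
      rw [h1]
      simp; ring
    _ = _ := by
      rw [integral_prod_mul (fun ξ : Metric.sphere (0 : EuclideanSpace ℝ (Fin d)) 1 =>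
        MvPolynomial.eval (fun i => (ξ : EuclideanSpace ℝ (Fin d)) i) P)
        (fun r : Set.Ioi (0:ℝ) => (r:ℝ) ^ k * Real.exp (-(r:ℝ)^2))]
      congr 1
      have hG := integral_rpow_mul_exp_neg_rpow (p := 2) (q := ((d - 1 + k : ℕ) : ℝ)) (by norm_num)
        (by linarith [Nat.cast_nonneg (α := ℝ) (d - 1 + k)])
      rw [← hG]
      simp only [Measure.volumeIoiPow, ENNReal.ofReal]
      rw [integral_withDensity_eq_integral_smul,
        integral_subtype_comap measurableSet_Ioi
          fun a ↦ Real.toNNReal (a ^ (d - 1)) • (a ^ k * Real.exp (-a^2)),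
        setIntegral_congr_fun measurableSet_Ioi fun x hx ↦ ?_]
      · rw [NNReal.smul_def, Real.coe_toNNReal _ (pow_nonneg hx.out.le _), smul_eq_mul,
          Real.rpow_natCast, pow_add, mul_assoc]
        simp
      · exact (measurable_subtype_coe.pow_const _).real_toNNReal

lemma sphere_orth {d m m' : ℕ} (hd : 2 ≤ d) {Y Y' : MvPolynomial (Fin d) ℝ}
    (hY : IsSphericalHarmonic d m Y)
    (hY' : IsSphericalHarmonic d m' Y') (h : m ≠ m') :
    ∫ ξ : Metric.sphere (0 : EuclideanSpace ℝ (Fin d)) 1,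
      MvPolynomial.eval (fun i => (ξ : EuclideanSpace ℝ (Fin d)) i) Y *
      MvPolynomial.eval (fun i => (ξ : EuclideanSpace ℝ (Fin d)) i) Y' ∂(sphereMeasure d) = 0 := by
  have h1 := gI_polar hd (hY.1.mul hY'.1)
  rw [gI_orth hY hY' h] at h1
  simp only [map_mul] at h1
  refine (mul_eq_zero.mp h1.symm).resolve_right ?_
  have := Real.Gamma_pos_of_pos (s := ((d - 1 + (m + m') : ℕ) + 1 : ℝ) / 2) (by positivity)
  positivity

theorem stmt15 (d : ℕ) (hd : 2 ≤ d)
    (m n m' n' : ℕ) (hmn : m ≤ n) (hmn' : m' ≤ n') (p : ℝ)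
    (hp : 2 * ((max n n' : ℕ) : ℝ) + d < p)
    (Y Y' : MvPolynomial (Fin d) ℝ)
    (hY : IsSphericalHarmonic d m Y) (hY' : IsSphericalHarmonic d m' Y') :
    (1 / (omegaSphere d * Real.Gamma (p - d))) *
      ∫ t in Set.Ioi (0 : ℝ),
        (∫ ξ : Metric.sphere (0 : EuclideanSpace ℝ (Fin d)) 1,
            finiteN (p - 2 * m - d + 1) (n - m) t *
              MvPolynomial.eval (fun i => t * (ξ : EuclideanSpace ℝ (Fin d)) i) Y *
            (finiteN (p - 2 * m' - d + 1) (n' - m') t *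
              MvPolynomial.eval (fun i => t * (ξ : EuclideanSpace ℝ (Fin d)) i) Y')
            ∂(sphereMeasure d)) *
        (t ^ ((d : ℝ) - 1 - p) * Real.exp (-1 / t)) =
    if n = n' ∧ m = m' then
      (((n - m).factorial : ℝ) * Real.Gamma (p - n - m - d + 1) /
          ((p - 2 * n - d) * Real.Gamma (p - d))) *
        ((1 / omegaSphere d) *
          ∫ ξ : Metric.sphere (0 : EuclideanSpace ℝ (Fin d)) 1,
            MvPolynomial.eval (fun i => (ξ : EuclideanSpace ℝ (Fin d)) i) Y *
              MvPolynomial.eval (fun i => (ξ : EuclideanSpace ℝ (Fin d)) i) Y'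
            ∂(sphereMeasure d))
    else 0 := by
  have hodd : ∀ t ∈ Set.Ioi (0:ℝ),
      (∫ ξ : Metric.sphere (0 : EuclideanSpace ℝ (Fin d)) 1,
            finiteN (p - 2 * m - d + 1) (n - m) t *
              MvPolynomial.eval (fun i => t * (ξ : EuclideanSpace ℝ (Fin d)) i) Y *
            (finiteN (p - 2 * m' - d + 1) (n' - m') t *
              MvPolynomial.eval (fun i => t * (ξ : EuclideanSpace ℝ (Fin d)) i) Y')
            ∂(sphereMeasure d)) *
        (t ^ ((d : ℝ) - 1 - p) * Real.exp (-1 / t)) =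
      (∫ ξ : Metric.sphere (0 : EuclideanSpace ℝ (Fin d)) 1,
            MvPolynomial.eval (fun i => (ξ : EuclideanSpace ℝ (Fin d)) i) Y *
              MvPolynomial.eval (fun i => (ξ : EuclideanSpace ℝ (Fin d)) i) Y'
            ∂(sphereMeasure d)) *
        (finiteN (p - 2 * m - d + 1) (n - m) t * finiteN (p - 2 * m' - d + 1) (n' - m') t *
          (t ^ (m + m') * (t ^ ((d : ℝ) - 1 - p) * Real.exp (-1 / t)))) := by
    intro t _
    have e : ∀ ξ : Metric.sphere (0 : EuclideanSpace ℝ (Fin d)) 1,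
        finiteN (p - 2 * m - d + 1) (n - m) t *
              MvPolynomial.eval (fun i => t * (ξ : EuclideanSpace ℝ (Fin d)) i) Y *
            (finiteN (p - 2 * m' - d + 1) (n' - m') t *
              MvPolynomial.eval (fun i => t * (ξ : EuclideanSpace ℝ (Fin d)) i) Y') =
        (finiteN (p - 2 * m - d + 1) (n - m) t * finiteN (p - 2 * m' - d + 1) (n' - m') t *
          t ^ (m + m')) * (MvPolynomial.eval (fun i => (ξ : EuclideanSpace ℝ (Fin d)) i) Y *
              MvPolynomial.eval (fun i => (ξ : EuclideanSpace ℝ (Fin d)) i) Y') := by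
      intro ξ
      rw [hom_eval hY.1, hom_eval hY'.1]; ring
    simp only [e]
    rw [integral_const_mul]; ring
  rw [setIntegral_congr_fun measurableSet_Ioi hodd, integral_const_mul]
  by_cases hm : m = m'
  swap
  · rw [sphere_orth hd hY hY' hm, if_neg (fun h => hm h.2)]
    simp
  subst hm
  have hpn : 2 * (n:ℝ) + d < p := by
    have : (n:ℝ) ≤ ((max n n' : ℕ) : ℝ) := by exact_mod_cast le_max_left _ _
    linarith
  have hq : 2 * ((max (n - m) (n' - m) : ℕ) : ℝ) + 1 < p - 2 * m - d + 1 := by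
    have h1 : max (n - m) (n' - m) + m ≤ max n n' := by omega
    have : ((max (n - m) (n' - m) : ℕ) : ℝ) + m ≤ ((max n n' : ℕ) : ℝ) := by exact_mod_cast h1
    linarith
  have key := orth_line (p - 2 * m - d + 1) (n - m) (n' - m) hq
  have e2 : ∫ t in Set.Ioi (0:ℝ), finiteN (p - 2 * m - d + 1) (n - m) t *
        finiteN (p - 2 * m - d + 1) (n' - m) t *
          (t ^ (m + m) * (t ^ ((d : ℝ) - 1 - p) * Real.exp (-1 / t))) =
      ∫ x in Set.Ioi (0:ℝ), finiteN (p - 2 * m - d + 1) (n - m) x *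
        finiteN (p - 2 * m - d + 1) (n' - m) x *
          (x ^ (-(p - 2 * m - d + 1)) * Real.exp (-1/x)) := by
    refine setIntegral_congr_fun measurableSet_Ioi fun t ht => ?_
    have ht : 0 < t := ht
    have : t ^ (-(p - 2 * m - d + 1)) = t ^ (m + m) * t ^ ((d : ℝ) - 1 - p) := by
      rw [← Real.rpow_natCast, ← Real.rpow_add ht]; congr 1; push_cast; ring
    simp only [this]; ring
  rw [e2, key]
  by_cases hn : n = n'
  swap
  · rw [if_neg (by omega), if_neg (fun h => hn h.1)]
    simp
  subst hn
  rw [if_pos rfl, if_pos ⟨rfl, rfl⟩, Nat.cast_sub hmn]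
  rw [show p - 2 * (m:ℝ) - d + 1 - (n - m) = p - n - m - d + 1 by ring,
    show p - 2 * (m:ℝ) - d + 1 - 2 * (n - m) - 1 = p - 2 * n - d by ring]
  simp only [div_eq_mul_inv, mul_inv]
  ring
end

section
/- Let d ≥ 2 be an integer, m ≤ n natural numbers, and p a real number. Define g(t) = N_{n−m}^{(p−2m−d+1)}(t) · t^m and g̃(t) = N_{n−m−1}^{(p−2m−d−1)}(t) · t^m for t > 0, with g̃ interpreted as 0 when n = m. Then for every t > 0: t² g″(t) + (1−p+d) t g′(t) = n(n−p+d) g(t) − (n−m)(p−n−m−d) g̃(t). (Equivalently, the surface-of-cone polynomials S_{n,m}^{p,N}(x,t) = N_{n−m}^{(p−2m−d+1)}(t)Y(x), with Y a degree-m spherical harmonic and x = tξ, satisfy t²∂_t² S_{n,m}^{p,N} + (1−p+d) t ∂_t S_{n,m}^{p,N} = n(n−p+d) S_{n,m}^{p,N} + (m−n)(p−n−m−d) S_{n−1,m}^{p−2,N}.) -/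
open Real

lemma phi_deriv (a : ℝ) (j : ℕ) (x : ℝ) (hx : 0 < x) :
    HasDerivAt (iteratedDeriv j (fun y : ℝ => y ^ a * Real.exp (-1 / y)))
      (iteratedDeriv (j+1) (fun y : ℝ => y ^ a * Real.exp (-1 / y)) x) x := by
  have hc : ContDiffAt ℝ ⊤ (fun y : ℝ => y ^ a * Real.exp (-1 / y)) x := by
    apply ContDiffAt.mul
    · exact Real.contDiffAt_rpow_const_of_ne hx.ne'
    · exact (contDiffAt_const.div contDiffAt_id hx.ne').exp
  rw [iteratedDeriv_succ]
  apply DifferentiableAt.hasDerivAt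
  have h := hc.analyticAt.iterated_deriv j
  rw [← iteratedDeriv_eq_iterate] at h
  exact h.differentiableAt

lemma W_deriv (s x : ℝ) (hx : 0 < x) (e : ℝ) :
    HasDerivAt (fun y : ℝ => y ^ s * Real.exp (e / y))
      ((s / x - e / x ^ 2) * (x ^ s * Real.exp (e / x))) x := by
  have h1 := Real.hasDerivAt_rpow_const (x := x) (p := s) (Or.inl hx.ne')
  have h2 := ((hasDerivAt_const x e).fun_div (hasDerivAt_id' x) hx.ne').exp
  refine (h1.fun_mul h2).congr_deriv ?_
  rw [Real.rpow_sub_one hx.ne']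
  field_simp
  ring

lemma phi_rec (a : ℝ) (j : ℕ) (x : ℝ) (hx : 0 < x) :
    x ^ 2 * iteratedDeriv (j+2) (fun y : ℝ => y ^ a * Real.exp (-1 / y)) x
    = ((a - 2 * (j + 1)) * x + 1) * iteratedDeriv (j+1) (fun y : ℝ => y ^ a * Real.exp (-1 / y)) x
      + (j + 1) * (a - j) * iteratedDeriv j (fun y : ℝ => y ^ a * Real.exp (-1 / y)) x := by
  have hD := phi_deriv a
  have h0 : ∀ x : ℝ, 0 < x → x ^ 2 * iteratedDeriv 1 (fun y : ℝ => y ^ a * Real.exp (-1 / y)) x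
      = (a * x + 1) * iteratedDeriv 0 (fun y : ℝ => y ^ a * Real.exp (-1 / y)) x := by
    intro x hx
    have h := W_deriv a x hx (-1)
    rw [iteratedDeriv_one, h.deriv, iteratedDeriv_zero]
    field_simp
    ring
  generalize hDD : (fun j => iteratedDeriv j (fun y : ℝ => y ^ a * Real.exp (-1 / y))) = D at *
  have e : ∀ j, iteratedDeriv j (fun y : ℝ => y ^ a * Real.exp (-1 / y)) = D j := by
    intro j; rw [← hDD]
  simp only [e] at *
  induction j generalizing x with
  | zero =>
    have hL := (hasDerivAt_pow 2 x).fun_mul (hD 1 x hx)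
    have hR := (((hasDerivAt_id' x).const_mul a).add_const 1).fun_mul (hD 0 x hx)
    have := hL.unique (hR.congr_of_eventuallyEq
      (by filter_upwards [lt_mem_nhds hx] with y hy using h0 y hy))
    norm_num at this ⊢
    linarith
  | succ j ih =>
    have hL := (hasDerivAt_pow 2 x).fun_mul (hD (j+2) x hx)
    have hR := ((((hasDerivAt_id' x).const_mul (a - 2 * (j + 1))).add_const 1).fun_mul
      (hD (j+1) x hx)).fun_add ((hD j x hx).const_mul ((j + 1) * (a - j)))
    have := hL.unique (hR.congr_of_eventuallyEq
      (by filter_upwards [lt_mem_nhds hx] with y hy using ih y hy))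
    norm_num at this ⊢
    linarith

lemma ode_core (m : ℕ) (q c : ℝ) (N M M' : ℝ → ℝ)
    (hN : ∀ x : ℝ, 0 < x → HasDerivAt N (c * M x) x)
    (hM : ∀ x : ℝ, 0 < x → HasDerivAt M (M' x) x)
    (hode : ∀ x : ℝ, 0 < x → c * (x ^ 2 * M' x) = - c * N x - c * ((2 - q) * x + 1) * M x)
    (t : ℝ) (ht : 0 < t) (g : ℝ → ℝ) (hg : ∀ t, g t = N t * t ^ m) :
    t ^ 2 * deriv (deriv g) t + (2 - q - 2 * m) * t * deriv g t
      = (m * (m + 1 - q - 2 * m) - c) * g t - c * (M t * t ^ m) := by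
  obtain rfl : g = fun t => N t * t ^ m := funext hg
  have hp : ∀ x : ℝ, 0 < x → HasDerivAt (fun x : ℝ => x ^ m) (m * x ^ m / x) x := by
    intro x hx
    refine (hasDerivAt_pow m x).congr_deriv ?_
    rcases m with _ | m
    · simp
    · rw [pow_succ]; field_simp; simp
  have h1 : ∀ x : ℝ, 0 < x → HasDerivAt (fun t => N t * t ^ m)
      (c * M x * x ^ m + N x * (m * x ^ m / x)) x := fun x hx => (hN x hx).fun_mul (hp x hx)
  have h2 : HasDerivAt (deriv (fun t => N t * t ^ m)) _ t :=
    ((((hM t ht).const_mul c).fun_mul (hp t ht)).fun_add ((hN t ht).fun_mul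
      (((hp t ht).const_mul (m:ℝ)).fun_div (hasDerivAt_id' t) ht.ne'))).congr_of_eventuallyEq
      (by filter_upwards [lt_mem_nhds ht] with y hy using (h1 y hy).deriv)
  rw [h2.deriv, (h1 t ht).deriv]
  have := hode t ht
  field_simp
  linear_combination this

lemma finiteN_succ_deriv (q : ℝ) (j : ℕ) (x : ℝ) (hx : 0 < x) :
    HasDerivAt (finiteN q (j+1)) ((j + 1) * (q - 2 - j) * finiteN (q - 2) j x) x ∧
    HasDerivAt (finiteN (q - 2) j)
      ((- finiteN q (j+1) x - ((2 - q) * x + 1) * finiteN (q - 2) j x) / x ^ 2) x := by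
  have ea : 2 * ((j + 1 : ℕ) : ℝ) - q = 2 * j - (q - 2) := by push_cast; ring
  have hr := phi_rec (2 * j - (q - 2)) j x hx
  have hD := phi_deriv (2 * j - (q - 2))
  have e1 : finiteN q (j+1) = fun x => (-1) ^ (j+1) * (x ^ q * Real.exp (1 / x) *
    iteratedDeriv (j+1) (fun y : ℝ => y ^ (2 * (j:ℝ) - (q - 2)) * Real.exp (-1 / y)) x) := by
    funext x; simp only [finiteN, ea]; ring
  have e2 : finiteN (q - 2) j = fun x => (-1) ^ j * (x ^ (q - 2) * Real.exp (1 / x) *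
    iteratedDeriv j (fun y : ℝ => y ^ (2 * (j:ℝ) - (q - 2)) * Real.exp (-1 / y)) x) := by
    funext x; simp only [finiteN]; ring
  have hq : x ^ q = x ^ (q - 2) * x ^ 2 := by
    rw [← Real.rpow_natCast x 2, ← Real.rpow_add hx]; norm_num
  have H1 := (((W_deriv q x hx 1).fun_mul (hD (j+1) x hx)).const_mul ((-1) ^ (j+1)))
  have H2 := (((W_deriv (q - 2) x hx 1).fun_mul (hD j x hx)).const_mul ((-1) ^ j))
  rw [e1, e2]
  constructor
  · refine H1.congr_deriv ?_
    simp only [hq, pow_succ (-1 : ℝ) j]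
    generalize hDD : (fun j' => iteratedDeriv j'
      (fun y : ℝ => y ^ (2 * (j:ℝ) - (q - 2)) * Real.exp (-1 / y))) = D at *
    have e : ∀ j', iteratedDeriv j'
      (fun y : ℝ => y ^ (2 * (j:ℝ) - (q - 2)) * Real.exp (-1 / y)) = D j' := by
      intro j'; rw [← hDD]
    simp only [e] at hr ⊢
    field_simp
    linear_combination -hr
  · refine H2.congr_deriv ?_
    simp only [hq, pow_succ (-1 : ℝ) j]
    field_simp
    ring

theorem stmt16 (d : ℕ) (hd : 2 ≤ d) (m n : ℕ) (hmn : m ≤ n) (p : ℝ)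
    (g gt : ℝ → ℝ)
    (hg : ∀ t : ℝ, g t = finiteN (p - 2 * m - d + 1) (n - m) t * t ^ m)
    (hgt : ∀ t : ℝ, gt t =
      if n = m then 0 else finiteN (p - 2 * m - d - 1) (n - m - 1) t * t ^ m) :
    ∀ t : ℝ, 0 < t →
      t ^ 2 * deriv (deriv g) t + (1 - p + d) * t * deriv g t
      = (n : ℝ) * ((n : ℝ) - p + d) * g t
        - ((n : ℝ) - m) * (p - n - m - d) * gt t := by
  intro t ht
  obtain ⟨k, rfl⟩ := Nat.exists_eq_add_of_le hmn
  simp only [Nat.add_sub_cancel_left] at hg hgt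
  rcases k with _ | j
  · have hN : ∀ x : ℝ, 0 < x → HasDerivAt (finiteN (p - 2 * m - d + 1) 0) (0 * 0) x := by
      intro x hx
      rw [zero_mul]
      refine (hasDerivAt_const x (1:ℝ)).congr_of_eventuallyEq ?_
      filter_upwards [lt_mem_nhds hx] with y hy
      have h1 : y ^ (p - 2 * m - d + 1) * y ^ (-(p - 2 * m - d + 1)) = 1 := by
        rw [← Real.rpow_add hy]; simp
      have h2 : Real.exp (1 / y) * Real.exp (-1 / y) = 1 := by
        rw [← Real.exp_add, neg_div]; simp
      simp only [finiteN, iteratedDeriv_zero, Nat.cast_zero, mul_zero, zero_sub, pow_zero, one_mul]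
      linear_combination h1 * (Real.exp (1 / y) * Real.exp (-1 / y)) + h2
    have := ode_core m (p - 2 * m - d + 1) 0 _ (fun _ => 0) (fun _ => 0) hN
      (fun x _ => hasDerivAt_const x 0) (by simp) t ht g hg
    push_cast
    linear_combination this
  · have := ode_core m (p - 2 * m - d + 1) ((j + 1) * ((p - 2 * m - d + 1) - 2 - j)) _ _ _
      (fun x hx => (finiteN_succ_deriv _ j x hx).1)
      (fun x hx => (finiteN_succ_deriv _ j x hx).2)
      (fun x hx => by field_simp) t ht g hg
    have e : p - 2 * m - d - 1 = p - 2 * m - d + 1 - 2 := by ring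
    rw [hgt t, if_neg (by omega), e, Nat.add_sub_cancel]
    push_cast
    linear_combination this
end
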